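/- Let f : I ⊆ [0, ∞) → ℝ be differentiable on I°, a, b ∈ I with a < b, and f' integrable on [a, b]. Suppose |f'|^2 is convex on [a, b]. Let d : a = x_0 < x_1 < ... < x_n = b be any division of [a, b], and set T(f, d) = Σ_{i=0}^{n−1} f((x_i + x_{i+1})/2)(x_{i+1} − x_i) and E(f, d) = ∫_a^b f(x) dx − T(f, d). Then |E(f, d)| ≤ (1/(2√6)) · Σ_{i=0}^{n−1} (x_{i+1} − x_i)^2 [ |f'(x_{i+1})|^2 + |f'(x_i)|^2 ]^{1/2}. -/

import Mathlib

open Set MeasureTheory intervalIntegral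

/-- A differentiable function with bounded derivative on `(p, q)` is integrable on `[p, q]`,
whatever its values at the endpoints. -/
lemma intervalIntegrable_of_abs_deriv_le {f : ℝ → ℝ} {p q K : ℝ} (hpq : p < q)
    (hf : ∀ t ∈ Ioo p q, DifferentiableAt ℝ f t) (hK : ∀ t ∈ Ioo p q, |deriv f t| ≤ K) :
    IntervalIntegrable f volume p q := by
  rw [intervalIntegrable_iff_integrableOn_Ioo_of_le hpq.le]
  have hm : (p + q) / 2 ∈ Ioo p q := ⟨by linarith, by linarith⟩
  have hK0 : 0 ≤ K := (abs_nonneg _).trans (hK _ hm)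
  have hcont : ContinuousOn f (Ioo p q) := fun t ht => (hf t ht).continuousAt.continuousWithinAt
  refine IntegrableOn.of_bound measure_Ioo_lt_top
    (hcont.aestronglyMeasurable measurableSet_Ioo) (|f ((p + q) / 2)| + K * (q - p)) ?_
  filter_upwards [ae_restrict_mem measurableSet_Ioo] with t ht
  have h := (convex_Ioo p q).norm_image_sub_le_of_norm_deriv_le hf hK hm ht
  have hd : ‖t - (p + q) / 2‖ ≤ q - p := by
    rw [Real.norm_eq_abs, abs_le]
    constructor <;> linarith [ht.1, ht.2]
  have h' := h.trans (mul_le_mul_of_nonneg_left hd hK0)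
  have htri := norm_sub_norm_le (f t) (f ((p + q) / 2))
  simp only [Real.norm_eq_abs] at *
  linarith

/-- The integral over an interval, folded about its midpoint. -/
lemma integral_sub_midpoint_eq {f : ℝ → ℝ} {m r : ℝ} (hr : 0 ≤ r)
    (hf : IntervalIntegrable f volume (m - r) (m + r)) :
    (∫ u in (m - r)..(m + r), f u) - f m * (2 * r)
      = ∫ s in (0 : ℝ)..r, (f (m + s) + f (m - s) - 2 * f m) := by
  have h1 : IntervalIntegrable f volume (m - r) m :=
    hf.mono_set (by rw [uIcc_of_le (by linarith), uIcc_of_le (by linarith)]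
                    exact Icc_subset_Icc_right (by linarith))
  have h2 : IntervalIntegrable f volume m (m + r) :=
    hf.mono_set (by rw [uIcc_of_le (by linarith), uIcc_of_le (by linarith)]
                    exact Icc_subset_Icc_left (by linarith))
  have h3 : IntervalIntegrable (fun s => f (m + s)) volume 0 r := by
    simpa using h2.comp_add_left m
  have h4 : IntervalIntegrable (fun s => f (m - s)) volume 0 r := by
    simpa using (h1.comp_sub_left m).symm
  rw [integral_sub (h3.add h4) intervalIntegrable_const, integral_add h3 h4,
    integral_comp_add_left, integral_comp_sub_left, intervalIntegral.integral_const,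
    ← integral_add_adjacent_intervals h1 h2]
  simp only [add_zero, sub_zero, smul_eq_mul]
  ring

/-- The midpoint rule on one interval, under convexity of the squared derivative. -/
lemma abs_integral_sub_midpoint_le {f : ℝ → ℝ} {p q : ℝ} (hpq : p < q)
    (hf : ∀ t ∈ Ioo p q, DifferentiableAt ℝ f t)
    (hconv : ConvexOn ℝ (Icc p q) (fun t => |deriv f t| ^ 2)) :
    |(∫ u in p..q, f u) - f ((p + q) / 2) * (q - p)|
      ≤ √2 / 8 * ((q - p) ^ 2 * √(|deriv f q| ^ 2 + |deriv f p| ^ 2)) := by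
  set S : ℝ := |deriv f q| ^ 2 + |deriv f p| ^ 2 with hS
  obtain ⟨m, hm⟩ : ∃ m, m = (p + q) / 2 := ⟨_, rfl⟩
  obtain ⟨r, hr⟩ : ∃ r, r = (q - p) / 2 := ⟨_, rfl⟩
  have hr0 : 0 < r := by linarith
  obtain rfl : p = m - r := by linarith
  obtain rfl : q = m + r := by linarith
  have hle : m - r ≤ m + r := hpq.le
  have hpt : ∀ c ∈ Icc (0 : ℝ) 1,
      |deriv f (c * (m - r) + (1 - c) * (m + r))| ^ 2
        ≤ c * |deriv f (m - r)| ^ 2 + (1 - c) * |deriv f (m + r)| ^ 2 := fun c hc => by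
    simpa using hconv.2 (left_mem_Icc.2 hle) (right_mem_Icc.2 hle) hc.1
      (sub_nonneg.2 hc.2) (by ring)
  have hbd : ∀ t ∈ Ioo (m - r) (m + r), |deriv f t| ≤ √S := fun t ht => by
    have hc0 : 0 ≤ (m + r - t) / (2 * r) := div_nonneg (by linarith [ht.2]) (by linarith)
    have hc1 : (m + r - t) / (2 * r) ≤ 1 := by
      rw [div_le_one (by linarith)]; linarith [ht.1]
    have h := hpt _ ⟨hc0, hc1⟩
    have ht' : (m + r - t) / (2 * r) * (m - r) + (1 - (m + r - t) / (2 * r)) * (m + r) = t := by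
      field_simp; ring
    rw [ht'] at h
    refine Real.le_sqrt_of_sq_le (h.trans ?_)
    nlinarith [mul_le_mul_of_nonneg_right hc1 (sq_nonneg |deriv f (m - r)|),
      mul_nonneg hc0 (sq_nonneg |deriv f (m + r)|)]
  have hsum : ∀ s ∈ Ico (0 : ℝ) r, |deriv f (m + s)| + |deriv f (m - s)| ≤ √(2 * S) :=
      fun s hs => by
    have hsr : s / r ≤ 1 := (div_le_one hr0).2 hs.2.le
    have hsr0 : 0 ≤ s / r := div_nonneg hs.1 hr0.le
    have h1 := hpt ((1 - s / r) / 2) ⟨by linarith, by linarith⟩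
    have h2 := hpt ((1 + s / r) / 2) ⟨by linarith, by linarith⟩
    have e1 : (1 - s / r) / 2 * (m - r) + (1 - (1 - s / r) / 2) * (m + r) = m + s := by
      field_simp; ring
    have e2 : (1 + s / r) / 2 * (m - r) + (1 - (1 + s / r) / 2) * (m + r) = m - s := by
      field_simp; ring
    rw [e1] at h1
    rw [e2] at h2
    refine Real.le_sqrt_of_sq_le ?_
    nlinarith [sq_nonneg (|deriv f (m + s)| - |deriv f (m - s)|)]
  have hφ : ∀ s ∈ Ico (0 : ℝ) r, |f (m + s) + f (m - s) - 2 * f m| ≤ √(2 * S) * s :=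
      fun s hs => by
    have hder : ∀ y ∈ Ico (0 : ℝ) r,
        HasDerivWithinAt (fun y => f (m + y) + f (m - y) - 2 * f m)
          (deriv f (m + y) - deriv f (m - y)) (Ico 0 r) y := fun y hy => by
      have d1 := (hf (m + y) ⟨by linarith [hy.1], by linarith [hy.2]⟩).hasDerivAt.comp_const_add m y
      have d2 := (hf (m - y) ⟨by linarith [hy.2], by linarith [hy.1]⟩).hasDerivAt.comp_const_sub m y
      simpa [sub_eq_add_neg] using ((d1.add d2).sub_const (2 * f m)).hasDerivWithinAt
    have h := (convex_Ico (0 : ℝ) r).norm_image_sub_le_of_norm_hasDerivWithin_le hder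
      (C := √(2 * S)) (fun y hy => (abs_sub _ _).trans (hsum y hy)) (left_mem_Ico.2 hr0) hs
    have hz : f (m + 0) + f (m - 0) - 2 * f m = 0 := by simp; ring
    rwa [hz, sub_zero, sub_zero, Real.norm_eq_abs, Real.norm_eq_abs, abs_of_nonneg hs.1] at h
  have hint := intervalIntegrable_of_abs_deriv_le hpq hf hbd
  have hfold := integral_sub_midpoint_eq hr0.le hint
  rw [← hm, show m + r - (m - r) = 2 * r by ring, hfold]
  have hae : ∀ᵐ s : ℝ, s ∈ Ioc (0 : ℝ) r →
      ‖f (m + s) + f (m - s) - 2 * f m‖ ≤ √(2 * S) * s := by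
    filter_upwards [Measure.ae_ne volume r] with s hne hs
    exact hφ s ⟨hs.1.le, lt_of_le_of_ne hs.2 hne⟩
  have h := intervalIntegral.norm_integral_le_of_norm_le hr0.le hae
    ((by fun_prop : Continuous fun s => √(2 * S) * s).intervalIntegrable 0 r)
  rw [Real.norm_eq_abs] at h
  refine h.trans (le_of_eq ?_)
  rw [intervalIntegral.integral_const_mul, integral_id, Real.sqrt_mul (by norm_num)]
  ring

/-- Proposition 4.2: midpoint quadrature error estimate when `|f'|^2` is convex on
`[a, b]`.  For a division `a = x 0 < x 1 < ... < x n = b`, the error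
`E(f,d) = ∫_a^b f − Σ_i f((x_i + x_{i+1})/2)(x_{i+1} − x_i)` satisfies the stated bound. -/
theorem midpoint_quadrature_error_sq
    (f : ℝ → ℝ) (I : Set ℝ) (hI : Convex ℝ I) (hI0 : I ⊆ Ici (0:ℝ))
    (a b : ℝ) (ha : a ∈ I) (hb : b ∈ I) (hab : a < b)
    (hdiff : DifferentiableOn ℝ f (interior I))
    (hint : IntervalIntegrable (deriv f) volume a b)
    (hconv : ConvexOn ℝ (Icc a b) (fun t => |deriv f t| ^ 2))
    (n : ℕ) (x : ℕ → ℝ) (hx0 : x 0 = a) (hxn : x n = b)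
    (hmono : ∀ i < n, x i < x (i + 1)) :
    |(∫ u in a..b, f u)
        - ∑ i ∈ Finset.range n, f ((x i + x (i + 1)) / 2) * (x (i + 1) - x i)|
      ≤ 1 / (2 * Real.sqrt 6) *
        ∑ i ∈ Finset.range n,
          (x (i + 1) - x i) ^ 2 *
            (|deriv f (x (i + 1))| ^ 2 + |deriv f (x i)| ^ 2) ^ ((1:ℝ) / 2) := by
  have hle : ∀ j ≤ n, ∀ i ≤ j, x i ≤ x j := fun j hj i hij => by
    induction j, hij using Nat.le_induction with
    | base => exact le_rfl
    | succ k _ ih => exact (ih (by omega)).trans (hmono k (by omega)).le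
  have hsub : ∀ i < n, Icc (x i) (x (i + 1)) ⊆ Icc a b := fun i hi =>
    Icc_subset_Icc (hx0 ▸ hle i hi.le 0 (Nat.zero_le _)) (hxn ▸ hle n le_rfl (i + 1) hi)
  have hIoo : Ioo a b ⊆ interior I :=
    interior_maximal (Ioo_subset_Icc_self.trans (hI.ordConnected.out ha hb)) isOpen_Ioo
  have hdiffAt : ∀ i < n, ∀ t ∈ Ioo (x i) (x (i + 1)), DifferentiableAt ℝ f t :=
      fun i hi t ht => by
    have h1 := (hsub i hi (left_mem_Icc.2 (hmono i hi).le)).1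
    have h2 := (hsub i hi (right_mem_Icc.2 (hmono i hi).le)).2
    exact hdiff.differentiableAt
      (isOpen_interior.mem_nhds (hIoo ⟨h1.trans_lt ht.1, ht.2.trans_le h2⟩))
  have hconv' : ∀ i < n, ConvexOn ℝ (Icc (x i) (x (i + 1))) (fun t => |deriv f t| ^ 2) :=
    fun i hi => hconv.subset (hsub i hi) (convex_Icc _ _)
  have hconst : √2 / 8 ≤ 1 / (2 * √6) := by
    rw [div_le_div_iff₀ (by norm_num) (by positivity)]
    have h12 : √2 * √6 ≤ 4 := by
      rw [← Real.sqrt_mul (by norm_num), Real.sqrt_le_left (by norm_num)]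
      norm_num
    linarith
  have hintf : ∀ i < n, IntervalIntegrable f volume (x i) (x (i + 1)) := fun i hi => by
    obtain ⟨K, hK⟩ : ∃ K, ∀ t ∈ Icc (x i) (x (i + 1)), |deriv f t| ^ 2 ≤ K :=
      ⟨_, fun t ht => (hconv' i hi).le_max_of_mem_Icc (left_mem_Icc.2 (hmono i hi).le)
        (right_mem_Icc.2 (hmono i hi).le) ht⟩
    exact intervalIntegrable_of_abs_deriv_le (hmono i hi) (hdiffAt i hi)
      fun t ht => Real.le_sqrt_of_sq_le (hK t (Ioo_subset_Icc_self ht))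
  rw [← hx0, ← hxn, ← sum_integral_adjacent_intervals hintf, ← Finset.sum_sub_distrib,
    Finset.mul_sum]
  refine (Finset.abs_sum_le_sum_abs _ _).trans (Finset.sum_le_sum fun i hi => ?_)
  have hi' := Finset.mem_range.1 hi
  rw [← Real.sqrt_eq_rpow]
  exact (abs_integral_sub_midpoint_le (hmono i hi') (hdiffAt i hi') (hconv' i hi')).trans
    (mul_le_mul_of_nonneg_right hconst (by positivity))
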